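/- arXiv:1902.00955 — 2 statements merged into one kernel-verified Lean document; each statement's English description precedes it below -/
import Mathlib

section
/- Fix β > 0 and h ∈ ℝ, and let F_rs(q) := ∫_ℝ log cosh(h + β√q x) dγ(x) + (β²/4)(1−q)². For every q > 0, F_rs is differentiable at q with F_rs'(q) = (β²/2)·( q − T(q) ), where T(q) = ∫_ℝ tanh²(h + β√q x) dγ(x). In particular, q ∈ (0,1) is a critical point of F_rs if and only if q satisfies the replica-symmetric fixed point equation q = ∫_ℝ tanh²(h + β√q x) dγ(x). -/
open Real MeasureTheory ProbabilityTheory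

/-- `T(q) = ∫ tanh²(h + β√q x) dγ(x)`. -/
noncomputable def T (β h q : ℝ) : ℝ :=
  ∫ x : ℝ, Real.tanh (h + β * Real.sqrt q * x) ^ 2 ∂(gaussianReal 0 1)

/-- The classical replica-symmetric functional of the SK model. -/
noncomputable def Frs (β h q : ℝ) : ℝ :=
  (∫ x : ℝ, Real.log (Real.cosh (h + β * Real.sqrt q * x)) ∂(gaussianReal 0 1))
    + β ^ 2 / 4 * (1 - q) ^ 2

theorem Real.hasDerivAt_log_cosh (x : ℝ) :
    HasDerivAt (fun y ↦ Real.log (Real.cosh y)) (Real.tanh x) x := by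
  simpa [Real.tanh_eq_sinh_div_cosh] using (Real.hasDerivAt_cosh x).log (Real.cosh_pos x).ne'

theorem Real.hasDerivAt_tanh_one_sub_sq (x : ℝ) :
    HasDerivAt Real.tanh (1 - Real.tanh x ^ 2) x := by
  have hc := (Real.cosh_pos x).ne'
  have hd := (Real.hasDerivAt_sinh x).div (Real.hasDerivAt_cosh x) hc
  have heq : Real.tanh = Real.sinh / Real.cosh := by
    ext y
    simp [Real.tanh_eq_sinh_div_cosh]
  rw [heq]
  refine hd.congr_deriv ?_
  simp only [Pi.div_apply]
  field_simp

theorem Real.differentiable_tanh_real : Differentiable ℝ Real.tanh := fun x ↦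
  (Real.hasDerivAt_tanh_one_sub_sq x).differentiableAt

theorem Real.abs_log_cosh_le_abs (x : ℝ) : |Real.log (Real.cosh x)| ≤ |x| := by
  rw [abs_of_nonneg (Real.log_nonneg (Real.one_le_cosh x)), Real.log_le_iff_le_exp
    (Real.cosh_pos x), ← Real.cosh_abs, Real.cosh_eq]
  have : Real.exp (-|x|) ≤ Real.exp |x| :=
    Real.exp_le_exp.2 (by linarith [abs_nonneg x])
  linarith

theorem ProbabilityTheory.integrable_gaussianReal_iff {f : ℝ → ℝ} {μ : ℝ} {v : NNReal}
    (hv : v ≠ 0) :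
    Integrable f (gaussianReal μ v) ↔ Integrable (fun x ↦ gaussianPDFReal μ v x * f x) := by
  rw [gaussianReal_of_var_ne_zero _ hv, integrable_withDensity_iff_integrable_smul'
    (measurable_gaussianPDF _ _) (ae_of_all _ fun _ ↦ gaussianPDF_lt_top)]
  simp [toReal_gaussianPDF]

theorem ProbabilityTheory.hasDerivAt_gaussianPDFReal_standard (x : ℝ) :
    HasDerivAt (gaussianPDFReal 0 1) (-x * gaussianPDFReal 0 1 x) x := by
  have hexp : HasDerivAt (fun y : ℝ ↦ -(y - 0) ^ 2 / (2 * ((1 : NNReal) : ℝ))) (-x) x := by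
    refine ((((hasDerivAt_id x).sub_const 0).pow 2).neg.div_const
      (2 * ((1 : NNReal) : ℝ))).congr_deriv ?_
    simp
    ring
  refine (hexp.exp.const_mul (√(2 * π * ((1 : NNReal) : ℝ)))⁻¹).congr_deriv ?_
  rw [gaussianPDFReal]
  ring

/-- Gaussian integration by parts. -/
theorem ProbabilityTheory.integral_id_mul_gaussianReal_eq_integral_deriv {f f' : ℝ → ℝ}
    (hf : ∀ x, HasDerivAt f (f' x) x) (hfi : Integrable f (gaussianReal 0 1))
    (hf'i : Integrable f' (gaussianReal 0 1))
    (hxf : Integrable (fun x ↦ x * f x) (gaussianReal 0 1)) :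
    ∫ x, x * f x ∂(gaussianReal 0 1) = ∫ x, f' x ∂(gaussianReal 0 1) := by
  rw [integrable_gaussianReal_iff one_ne_zero] at hfi hf'i hxf
  have hparts := integral_mul_deriv_eq_deriv_mul_of_integrable
    (u := gaussianPDFReal 0 1) (v := f) (u' := fun x ↦ -x * gaussianPDFReal 0 1 x) (v' := f')
    (fun x _ ↦ hasDerivAt_gaussianPDFReal_standard x) (fun x _ ↦ hf x) hf'i
    (by
      refine hxf.neg.congr (ae_of_all _ fun x ↦ ?_)
      simp only [Pi.neg_apply, Pi.mul_apply]
      ring) hfi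
  rw [integral_gaussianReal_eq_integral_smul one_ne_zero,
    integral_gaussianReal_eq_integral_smul one_ne_zero]
  simp only [smul_eq_mul]
  rw [hparts, ← integral_neg]
  congr 1 with x
  ring

theorem integrable_id_standard_gaussianReal :
    Integrable (fun x : ℝ ↦ x) (gaussianReal 0 1) :=
  (memLp_id_gaussianReal (μ := 0) (v := 1) 1).integrable le_rfl

theorem integrable_tanh_sq_gaussianReal (h c : ℝ) :
    Integrable (fun x ↦ Real.tanh (h + c * x) ^ 2) (gaussianReal 0 1) := by
  have := Real.differentiable_tanh_real.continuous
  refine (integrable_const (1 : ℝ)).mono'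
    (Continuous.aestronglyMeasurable (by fun_prop)) (ae_of_all _ fun x ↦ ?_)
  rw [Real.norm_of_nonneg (sq_nonneg _)]
  exact (Real.tanh_sq_lt_one _).le

theorem integral_id_mul_tanh_gaussianReal (h c : ℝ) :
    ∫ x, x * Real.tanh (h + c * x) ∂(gaussianReal 0 1)
      = c * (1 - ∫ x, Real.tanh (h + c * x) ^ 2 ∂(gaussianReal 0 1)) := by
  have hcont := Real.differentiable_tanh_real.continuous
  have hsq := integrable_tanh_sq_gaussianReal h c
  have hderiv (x : ℝ) : HasDerivAt (fun y ↦ Real.tanh (h + c * y))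
      (c * (1 - Real.tanh (h + c * x) ^ 2)) x := by
    have hlin : HasDerivAt (fun y ↦ h + c * y) c x := by
      simpa using ((hasDerivAt_id x).const_mul c).const_add h
    rw [mul_comm]
    exact (Real.hasDerivAt_tanh_one_sub_sq _).comp x hlin
  rw [ProbabilityTheory.integral_id_mul_gaussianReal_eq_integral_deriv hderiv,
    integral_const_mul, integral_sub (integrable_const _) hsq]
  · simp
  · refine (integrable_const (1 : ℝ)).mono'
      (Continuous.aestronglyMeasurable (by fun_prop)) (ae_of_all _ fun x ↦ ?_)
    exact (Real.abs_tanh_lt_one _).le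
  · exact ((integrable_const _).sub hsq).const_mul c
  · refine integrable_id_standard_gaussianReal.norm.mono'
      (Continuous.aestronglyMeasurable (by fun_prop)) (ae_of_all _ fun x ↦ ?_)
    rw [norm_mul]
    exact mul_le_of_le_one_right (norm_nonneg _) (Real.abs_tanh_lt_one _).le

theorem hasDerivAt_integral_log_cosh_gaussianReal (h c : ℝ) :
    HasDerivAt (fun s ↦ ∫ x, Real.log (Real.cosh (h + s * x)) ∂(gaussianReal 0 1))
      (c * (1 - ∫ x, Real.tanh (h + c * x) ^ 2 ∂(gaussianReal 0 1))) c := by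
  have hcont := Real.differentiable_tanh_real.continuous
  have hlog : Continuous fun y ↦ Real.log (Real.cosh y) :=
    Real.continuous_cosh.log fun y ↦ (Real.cosh_pos y).ne'
  have hmeas (s : ℝ) : AEStronglyMeasurable (fun x ↦ Real.log (Real.cosh (h + s * x)))
      (gaussianReal 0 1) :=
    (hlog.comp (by fun_prop : Continuous fun x ↦ h + s * x)).aestronglyMeasurable
  rw [← integral_id_mul_tanh_gaussianReal]
  refine (hasDerivAt_integral_of_dominated_loc_of_deriv_le (s := Set.univ) Filter.univ_mem
    (Filter.Eventually.of_forall hmeas) ?_ (F' := fun s x ↦ x * Real.tanh (h + s * x))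
    (Continuous.aestronglyMeasurable (by fun_prop)) (bound := fun x ↦ ‖x‖)
    (ae_of_all _ fun x s _ ↦ ?_) integrable_id_standard_gaussianReal.norm
    (ae_of_all _ fun x s _ ↦ ?_)).2
  · exact ((integrable_const h).add (integrable_id_standard_gaussianReal.const_mul c)).norm.mono'
      (hmeas c) (ae_of_all _ fun x ↦ Real.abs_log_cosh_le_abs _)
  · rw [norm_mul]
    exact mul_le_of_le_one_right (norm_nonneg _) (Real.abs_tanh_lt_one _).le
  · have hlin : HasDerivAt (fun s ↦ h + s * x) x s := by
      simpa using ((hasDerivAt_id s).mul_const x).const_add h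
    rw [mul_comm]
    exact (Real.hasDerivAt_log_cosh _).comp s hlin

theorem hasDerivAt_Frs (β h : ℝ) {q : ℝ} (hq : 0 < q) :
    HasDerivAt (Frs β h) (β ^ 2 / 2 * (q - T β h q)) q := by
  have hs := (Real.hasDerivAt_sqrt hq.ne').const_mul β
  have hcomp := (hasDerivAt_integral_log_cosh_gaussianReal h (β * √q)).comp q hs
  have hquad := ((((hasDerivAt_id q).const_sub 1).pow 2).const_mul (β ^ 2 / 4))
  refine (hcomp.add hquad).congr_deriv ?_
  have hne := (Real.sqrt_pos.2 hq).ne'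
  simp only [T, id]
  field_simp
  ring

/-- For `q > 0`, `F_rs` is differentiable with `F_rs'(q) = (β²/2)(q − T(q))`;
in particular `q ∈ (0,1)` is a critical point of `F_rs` iff `q = T(q)`. -/
theorem Frs_deriv_and_critical (β : ℝ) (hβ : 0 < β) (h : ℝ) :
    (∀ q : ℝ, 0 < q → HasDerivAt (Frs β h) (β ^ 2 / 2 * (q - T β h q)) q) ∧
    (∀ q ∈ Set.Ioo (0 : ℝ) 1, deriv (Frs β h) q = 0 ↔ q = T β h q) := by
  refine ⟨fun q hq ↦ hasDerivAt_Frs β h hq, fun q hq ↦ ?_⟩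
  rw [(hasDerivAt_Frs β h hq.1).deriv, mul_eq_zero, sub_eq_zero]
  exact or_iff_right (by positivity)
end

section
/- For every β > 0 and h ∈ ℝ, there exists q̂ ∈ [0,1] solving the replica-symmetric fixed point equation q̂ = ∫_ℝ tanh²(h + β√q̂ x) dγ(x). -/
open Real MeasureTheory ProbabilityTheory

theorem continuous_real_tanh : Continuous Real.tanh := by
  have : Real.tanh = fun x => Real.sinh x / Real.cosh x := funext Real.tanh_eq_sinh_div_cosh
  rw [this]
  exact Real.continuous_sinh.div Real.continuous_cosh fun x => ne_of_gt (Real.cosh_pos x)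

/-- Existence of a solution of the replica-symmetric fixed point equation
`q̂ = ∫ tanh²(h + β√q̂ x) dγ(x)` in `[0,1]`. -/
theorem rs_fixed_point_exists (β : ℝ) (hβ : 0 < β) (h : ℝ) :
    ∃ q ∈ Set.Icc (0 : ℝ) 1,
      q = ∫ x : ℝ, Real.tanh (h + β * Real.sqrt q * x) ^ 2 ∂(gaussianReal 0 1) := by
  have hcont : Continuous fun q : ℝ =>
      ∫ x : ℝ, Real.tanh (h + β * Real.sqrt q * x) ^ 2 ∂(gaussianReal 0 1) := by
    refine continuous_of_dominated (bound := fun _ => 1) (fun q => ?_) (fun q => ?_)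
      (integrable_const _) (ae_of_all _ fun x => ?_)
    · exact ((continuous_real_tanh.comp (by fun_prop)).pow 2).aestronglyMeasurable
    · refine ae_of_all _ fun x => ?_
      rw [Real.norm_of_nonneg (sq_nonneg _)]
      exact (Real.tanh_sq_lt_one _).le
    · exact (continuous_real_tanh.comp (by fun_prop)).pow 2
  obtain ⟨q, hq, hfix⟩ := exists_mem_Icc_isFixedPt_of_mapsTo hcont.continuousOn zero_le_one
    fun q _ => ⟨integral_nonneg fun x => sq_nonneg _, by
      simpa using integral_mono_of_nonneg (μ := gaussianReal 0 1)
        (ae_of_all _ fun x => sq_nonneg (Real.tanh (h + β * Real.sqrt q * x)))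
        (integrable_const 1) (ae_of_all _ fun x => (Real.tanh_sq_lt_one _).le)⟩
  exact ⟨q, hq, hfix.symm⟩
end
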